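/- arXiv:1707.08297 — 2 statements merged into one kernel-verified Lean document; each statement's English description precedes it below -/
import Mathlib

section
/- For every n ≥ 1 and every S ⊆ [n], the following identity of polynomials in t holds, where r = n − |S|: Σ_{S ⊆ T ⊆ [n]} (−1)^{n−|T|} φ_t(T) equals 0 if [n]∖S contains two consecutive integers; equals t^r(1+t)^{n−2r} if [n]∖S contains no two consecutive integers and n ∈ S; and equals t^r(1+t)^{n+1−2r} if [n]∖S contains no two consecutive integers and n ∉ S. -/
/-!
STATEMENT 4: For every n ≥ 1 and every S ⊆ [n], with r = n − |S|:
Σ_{S ⊆ T ⊆ [n]} (−1)^{n−|T|} φ_t(T) equals 0 if [n]∖S contains two consecutive integers;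
equals t^r(1+t)^{n−2r} if [n]∖S is stable and n ∈ S; and equals t^r(1+t)^{n+1−2r} if
[n]∖S is stable and n ∉ S.
-/

noncomputable section

/-- `[m]_t = 1 + t + ⋯ + t^{m-1}` as a polynomial in the indeterminate `t` over `ℤ`. -/
def qt (m : ℕ) : Polynomial ℤ := ∑ i ∈ Finset.range m, Polynomial.X ^ i

/-- Helper: given the previous element `prev` and the (sorted, increasing) list of remaining
elements `s₁ < s₂ < ⋯`, returns `[s₁ - prev + 1]_t [s₂ - s₁ + 1]_t ⋯`. -/
def phiAux : ℕ → List ℕ → Polynomial ℤ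
  | _, [] => 1
  | prev, s :: rest => qt (s - prev + 1) * phiAux s rest

/-- `φ_t(T) = [s₁+1]_t [s₂−s₁+1]_t ⋯ [s_k−s_{k−1}+1]_t` for `T = {s₁ < s₂ < ⋯ < s_k}`,
with `φ_t(∅) = 1`. -/
def phi (T : Finset ℕ) : Polynomial ℤ := phiAux 0 (T.sort (· ≤ ·))

/-- The last element of `T` in increasing order, or `0` if `T` is empty. -/
def lastElem (T : Finset ℕ) : ℕ := (T.sort (· ≤ ·)).getLastD 0

theorem qt_succ (m : ℕ) : qt (m + 1) = 1 + Polynomial.X * qt m := by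
  simp only [qt, Finset.sum_range_succ', pow_zero, Finset.mul_sum]
  rw [add_comm]
  congr 1
  exact Finset.sum_congr rfl fun i _ => pow_succ' _ _

theorem qt_one : qt 1 = 1 := by simp [qt]

theorem phiAux_concat (l : List ℕ) (p x : ℕ) :
    phiAux p (l ++ [x]) = phiAux p l * qt (x - l.getLastD p + 1) := by
  induction l generalizing p with
  | nil => simp [phiAux]
  | cons s l ih =>
    rw [List.cons_append, phiAux, phiAux, ih, List.getLastD_cons, mul_assoc]

theorem sort_insert_of_forall_lt {T : Finset ℕ} {x : ℕ} (h : ∀ y ∈ T, y < x) :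
    (insert x T).sort (· ≤ ·) = T.sort (· ≤ ·) ++ [x] := by
  have hx : x ∉ T := fun hx => lt_irrefl _ (h x hx)
  refine List.Perm.eq_of_pairwise' (r := (· ≤ ·)) (Finset.pairwise_sort _ _) ?_ ?_
  · rw [List.pairwise_append]
    refine ⟨Finset.pairwise_sort _ _, List.pairwise_singleton _ _, fun a ha b hb => ?_⟩
    rw [List.mem_singleton] at hb
    exact hb ▸ (h a ((Finset.mem_sort _).1 ha)).le
  · rw [List.perm_ext_iff_of_nodup (Finset.sort_nodup _ _)]
    · intro a
      simp [or_comm]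
    · rw [List.nodup_append]
      refine ⟨Finset.sort_nodup _ _, List.nodup_singleton _, fun a ha b hb => ?_⟩
      rw [List.mem_singleton] at hb
      exact hb ▸ (h a ((Finset.mem_sort _).1 ha)).ne

theorem phi_insert {T : Finset ℕ} {x : ℕ} (h : ∀ y ∈ T, y < x) :
    phi (insert x T) = phi T * qt (x - lastElem T + 1) := by
  rw [phi, sort_insert_of_forall_lt h, phiAux_concat, phi, lastElem]

theorem lastElem_insert {T : Finset ℕ} {x : ℕ} (h : ∀ y ∈ T, y < x) :
    lastElem (insert x T) = x := by
  rw [lastElem, sort_insert_of_forall_lt h]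
  simp

theorem lastElem_le {T : Finset ℕ} {m : ℕ} (h : T ⊆ Finset.Icc 1 m) : lastElem T ≤ m := by
  rw [lastElem, List.getLastD_eq_getLast?]
  cases hl : (T.sort (· ≤ ·)).getLast? with
  | none => simp
  | some a =>
    exact (Finset.mem_Icc.1 (h ((Finset.mem_sort _).1 (List.mem_of_getLast? hl)))).2

/-- The signed contribution of `T ⊆ [m]` to the sum over the sets containing `S ∩ [m]`. -/
def signedPhi (S : Finset ℕ) (m : ℕ) (T : Finset ℕ) : Polynomial ℤ :=
  if S ∩ Finset.Icc 1 m ⊆ T then (-1) ^ (m - T.card) * phi T else 0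

/-- The alternating sum of `φ_t(T)` over `S ∩ [m] ⊆ T ⊆ [m]`. -/
def phiSum (S : Finset ℕ) (m : ℕ) : Polynomial ℤ :=
  ∑ T ∈ (Finset.Icc 1 m).powerset, signedPhi S m T

/-- The alternating sum of `φ_t(T) [m - max T + 1]_t` over `S ∩ [m] ⊆ T ⊆ [m]`. -/
def phiGapSum (S : Finset ℕ) (m : ℕ) : Polynomial ℤ :=
  ∑ T ∈ (Finset.Icc 1 m).powerset, signedPhi S m T * qt (m - lastElem T + 1)

theorem Icc_one_succ (m : ℕ) : Finset.Icc 1 (m + 1) = insert (m + 1) (Finset.Icc 1 m) := by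
  ext i
  simp only [Finset.mem_Icc, Finset.mem_insert]
  omega

theorem succ_notMem_Icc_one (m : ℕ) : m + 1 ∉ Finset.Icc 1 m := by simp

theorem lt_succ_of_subset_Icc {T : Finset ℕ} {m : ℕ} (h : T ⊆ Finset.Icc 1 m) :
    ∀ y ∈ T, y < m + 1 := fun _ hy => Nat.lt_succ_of_le (Finset.mem_Icc.1 (h hy)).2

theorem signedPhi_succ (S : Finset ℕ) {m : ℕ} {T : Finset ℕ} (h : T ⊆ Finset.Icc 1 m) :
    signedPhi S (m + 1) T = if m + 1 ∈ S then 0 else -signedPhi S m T := by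
  have hT : m + 1 ∉ T := fun hT => succ_notMem_Icc_one m (h hT)
  have hc : T.card ≤ m := by simpa using Finset.card_le_card h
  by_cases hS : m + 1 ∈ S
  · rw [if_pos hS, signedPhi, if_neg]
    exact fun hsub => hT (hsub (by simp [hS]))
  · have hI : S ∩ Finset.Icc 1 (m + 1) = S ∩ Finset.Icc 1 m := by
      rw [Icc_one_succ, Finset.inter_insert_of_notMem hS]
    rw [if_neg hS, signedPhi, signedPhi, hI, Nat.sub_add_comm hc, pow_succ]
    split_ifs <;> ring

theorem signedPhi_succ_insert (S : Finset ℕ) {m : ℕ} {T : Finset ℕ} (h : T ⊆ Finset.Icc 1 m) :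
    signedPhi S (m + 1) (insert (m + 1) T) =
      signedPhi S m T * (1 + Polynomial.X * qt (m - lastElem T + 1)) := by
  have hT : m + 1 ∉ T := fun hT => succ_notMem_Icc_one m (h hT)
  have hI : S ∩ Finset.Icc 1 (m + 1) ⊆ insert (m + 1) T ↔ S ∩ Finset.Icc 1 m ⊆ T := by
    constructor
    · intro hsub i hi
      have hi' := Finset.mem_inter.1 hi
      have hle := Finset.mem_Icc.1 hi'.2
      rcases Finset.mem_insert.1 (hsub (Finset.mem_inter.2
        ⟨hi'.1, Finset.mem_Icc.2 ⟨hle.1, by omega⟩⟩)) with h1 | h1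
      · omega
      · exact h1
    · intro hsub i hi
      rw [Icc_one_succ] at hi
      have hi' := Finset.mem_inter.1 hi
      rcases Finset.mem_insert.1 hi'.2 with h1 | h1
      · exact Finset.mem_insert.2 (Or.inl h1)
      · exact Finset.mem_insert_of_mem (hsub (Finset.mem_inter.2 ⟨hi'.1, h1⟩))
  simp only [signedPhi, hI]
  rw [phi_insert (lt_succ_of_subset_Icc h), Finset.card_insert_of_notMem hT,
    Nat.add_sub_add_right, Nat.sub_add_comm (lastElem_le h), qt_succ]
  split_ifs <;> ring

theorem phiSum_zero (S : Finset ℕ) : phiSum S 0 = 1 := by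
  simp [phiSum, signedPhi, phi, phiAux]

theorem phiGapSum_zero (S : Finset ℕ) : phiGapSum S 0 = 1 := by
  simp [phiGapSum, signedPhi, phi, phiAux, qt_one]

theorem sum_signedPhi_succ_insert (S : Finset ℕ) (m : ℕ) :
    ∑ T ∈ (Finset.Icc 1 m).powerset, signedPhi S (m + 1) (insert (m + 1) T) =
      phiSum S m + Polynomial.X * phiGapSum S m := by
  rw [phiSum, phiGapSum, Finset.mul_sum, ← Finset.sum_add_distrib]
  refine Finset.sum_congr rfl fun T hT => ?_
  rw [signedPhi_succ_insert S (Finset.mem_powerset.1 hT)]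
  ring

theorem phiSum_succ (S : Finset ℕ) (m : ℕ) :
    phiSum S (m + 1) = (if m + 1 ∈ S then 0 else -phiSum S m) +
      (phiSum S m + Polynomial.X * phiGapSum S m) := by
  rw [phiSum, Icc_one_succ, Finset.sum_powerset_insert (succ_notMem_Icc_one m),
    sum_signedPhi_succ_insert,
    Finset.sum_congr rfl fun T hT => signedPhi_succ S (Finset.mem_powerset.1 hT)]
  congr 1
  split_ifs
  · simp
  · rw [Finset.sum_neg_distrib, phiSum]

theorem phiGapSum_succ (S : Finset ℕ) (m : ℕ) :
    phiGapSum S (m + 1) =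
      (if m + 1 ∈ S then 0 else -(phiSum S m + Polynomial.X * phiGapSum S m)) +
      (phiSum S m + Polynomial.X * phiGapSum S m) := by
  rw [phiGapSum, Icc_one_succ, Finset.sum_powerset_insert (succ_notMem_Icc_one m)]
  congr 1
  · split_ifs with hS
    · refine Finset.sum_eq_zero fun T hT => ?_
      rw [signedPhi_succ S (Finset.mem_powerset.1 hT), if_pos hS, zero_mul]
    · rw [phiSum, phiGapSum, Finset.mul_sum, ← Finset.sum_add_distrib, ← Finset.sum_neg_distrib]
      refine Finset.sum_congr rfl fun T hT => ?_
      have h := Finset.mem_powerset.1 hT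
      rw [signedPhi_succ S h, if_neg hS, Nat.sub_add_comm (lastElem_le h), qt_succ]
      ring
  · rw [← sum_signedPhi_succ_insert]
    refine Finset.sum_congr rfl fun T hT => ?_
    rw [lastElem_insert (lt_succ_of_subset_Icc (Finset.mem_powerset.1 hT)), Nat.sub_self,
      zero_add, qt_one, mul_one]

theorem phiSum_succ_of_mem {S : Finset ℕ} {m : ℕ} (h : m + 1 ∈ S) :
    phiSum S (m + 1) = phiSum S m + Polynomial.X * phiGapSum S m := by
  rw [phiSum_succ, if_pos h, zero_add]

theorem phiGapSum_succ_of_mem {S : Finset ℕ} {m : ℕ} (h : m + 1 ∈ S) :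
    phiGapSum S (m + 1) = phiSum S m + Polynomial.X * phiGapSum S m := by
  rw [phiGapSum_succ, if_pos h, zero_add]

theorem phiSum_succ_of_notMem {S : Finset ℕ} {m : ℕ} (h : m + 1 ∉ S) :
    phiSum S (m + 1) = Polynomial.X * phiGapSum S m := by
  rw [phiSum_succ, if_neg h]
  ring

theorem phiGapSum_succ_of_notMem {S : Finset ℕ} {m : ℕ} (h : m + 1 ∉ S) :
    phiGapSum S (m + 1) = 0 := by
  rw [phiGapSum_succ, if_neg h]
  ring

theorem phiSum_eq_zero {S : Finset ℕ} {i m : ℕ} (h1 : 1 ≤ i) (hi : i ∉ S) (hi' : i + 1 ∉ S)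
    (him : i + 1 ≤ m) : phiSum S m = 0 ∧ phiGapSum S m = 0 := by
  induction m, him using Nat.le_induction with
  | base =>
    obtain ⟨j, rfl⟩ := Nat.exists_eq_add_of_le' h1
    exact ⟨by rw [phiSum_succ_of_notMem hi', phiGapSum_succ_of_notMem hi, mul_zero],
      phiGapSum_succ_of_notMem hi'⟩
  | succ m _ ih =>
    rw [phiSum_succ, phiGapSum_succ, ih.1, ih.2]
    simp

theorem card_sdiff_succ_of_mem {S : Finset ℕ} {m : ℕ} (h : m + 1 ∈ S) :
    (Finset.Icc 1 (m + 1) \ S).card = (Finset.Icc 1 m \ S).card := by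
  rw [Icc_one_succ, Finset.insert_sdiff_of_mem _ h]

theorem card_sdiff_succ_of_notMem {S : Finset ℕ} {m : ℕ} (h : m + 1 ∉ S) :
    (Finset.Icc 1 (m + 1) \ S).card = (Finset.Icc 1 m \ S).card + 1 := by
  rw [Icc_one_succ, Finset.insert_sdiff_of_notMem _ h, Finset.card_insert_of_notMem]
  simp

theorem phiSum_of_stable {S : Finset ℕ} {m : ℕ}
    (h : ∀ i, 1 ≤ i → i + 1 ≤ m → i ∉ S → i + 1 ∈ S) :
    ((m = 0 ∨ m ∈ S) → 2 * (Finset.Icc 1 m \ S).card ≤ m ∧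
      phiSum S m = Polynomial.X ^ (Finset.Icc 1 m \ S).card *
        (1 + Polynomial.X) ^ (m - 2 * (Finset.Icc 1 m \ S).card) ∧
      phiGapSum S m = phiSum S m) ∧
    (m ≠ 0 → m ∉ S → 2 * (Finset.Icc 1 m \ S).card ≤ m + 1 ∧
      phiSum S m = Polynomial.X ^ (Finset.Icc 1 m \ S).card *
        (1 + Polynomial.X) ^ (m + 1 - 2 * (Finset.Icc 1 m \ S).card)) := by
  induction m with
  | zero => simp [phiSum_zero, phiGapSum_zero]
  | succ m ih =>
    obtain ⟨ih1, ih2⟩ := ih fun i h1 him => h i h1 (by omega)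
    refine ⟨fun hm => ?_, fun _ hm => ?_⟩
    · replace hm : m + 1 ∈ S := hm.resolve_left (Nat.succ_ne_zero m)
      rw [card_sdiff_succ_of_mem hm, phiSum_succ_of_mem hm, phiGapSum_succ_of_mem hm]
      by_cases hm' : m = 0 ∨ m ∈ S
      · obtain ⟨hle, hs, hg⟩ := ih1 hm'
        refine ⟨by omega, ?_, rfl⟩
        rw [hg, hs, Nat.sub_add_comm hle, pow_succ]
        ring
      · push Not at hm'
        obtain ⟨hle, hs⟩ := ih2 hm'.1 hm'.2
        obtain ⟨k, rfl⟩ := Nat.exists_eq_succ_of_ne_zero hm'.1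
        refine ⟨hle, ?_, rfl⟩
        rw [phiGapSum_succ_of_notMem hm'.2, mul_zero, add_zero, hs]
    · have hm' : m = 0 ∨ m ∈ S := by
        by_contra! hcon
        exact hm (h m (Nat.one_le_iff_ne_zero.2 hcon.1) le_rfl hcon.2)
      obtain ⟨hle, hs, hg⟩ := ih1 hm'
      rw [card_sdiff_succ_of_notMem hm, phiSum_succ_of_notMem hm, hg, hs]
      refine ⟨by omega, ?_⟩
      rw [show m + 1 + 1 - 2 * ((Finset.Icc 1 m \ S).card + 1) =
        m - 2 * (Finset.Icc 1 m \ S).card by omega, pow_succ]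
      ring

theorem phi_alternating_sum (n : ℕ) (hn : 1 ≤ n) (S : Finset ℕ) (hS : S ⊆ Finset.Icc 1 n) :
    ((∃ i, i ∈ Finset.Icc 1 n \ S ∧ i + 1 ∈ Finset.Icc 1 n \ S) →
      ∑ T ∈ (Finset.Icc 1 n).powerset.filter (fun T => S ⊆ T),
          (-1 : Polynomial ℤ) ^ (n - T.card) * phi T = 0) ∧
    ((∀ i ∈ Finset.Icc 1 n \ S, i + 1 ∉ Finset.Icc 1 n \ S) → n ∈ S →
      ∑ T ∈ (Finset.Icc 1 n).powerset.filter (fun T => S ⊆ T),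
          (-1 : Polynomial ℤ) ^ (n - T.card) * phi T =
        Polynomial.X ^ (n - S.card) * (1 + Polynomial.X) ^ (n - 2 * (n - S.card))) ∧
    ((∀ i ∈ Finset.Icc 1 n \ S, i + 1 ∉ Finset.Icc 1 n \ S) → n ∉ S →
      ∑ T ∈ (Finset.Icc 1 n).powerset.filter (fun T => S ⊆ T),
          (-1 : Polynomial ℤ) ^ (n - T.card) * phi T =
        Polynomial.X ^ (n - S.card) * (1 + Polynomial.X) ^ (n + 1 - 2 * (n - S.card))) := by
  have hsum : ∑ T ∈ (Finset.Icc 1 n).powerset.filter (fun T => S ⊆ T),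
      (-1 : Polynomial ℤ) ^ (n - T.card) * phi T = phiSum S n := by
    rw [Finset.sum_filter, phiSum]
    simp only [signedPhi, Finset.inter_eq_left.2 hS]
  have hcard : n - S.card = (Finset.Icc 1 n \ S).card := by
    rw [Finset.card_sdiff_of_subset hS, Nat.card_Icc, Nat.add_sub_cancel]
  have hstable (h : ∀ i ∈ Finset.Icc 1 n \ S, i + 1 ∉ Finset.Icc 1 n \ S) :
      ∀ i, 1 ≤ i → i + 1 ≤ n → i ∉ S → i + 1 ∈ S := by
    intro i h1 hin hi
    by_contra hi'
    exact h i (by simp [hi, h1]; omega) (by simp [hi', hin])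
  rw [hsum, hcard]
  refine ⟨?_, fun h hn' => ?_, fun h hn' => ?_⟩
  · rintro ⟨i, hi, hi'⟩
    simp only [Finset.mem_sdiff, Finset.mem_Icc] at hi hi'
    exact (phiSum_eq_zero hi.1.1 hi.2 hi'.2 hi'.1.2).1
  · exact ((phiSum_of_stable (hstable h)).1 (Or.inr hn')).2.1
  · exact ((phiSum_of_stable (hstable h)).2 (by omega) hn').2

end
end

section
/- Let n ≥ 1, let P be a finite bounded graded poset of rank n+1 with a finite group G acting on it by order-preserving bijections, and let t be a positive integer. Let Q (respectively R) be the bounded graded poset of rank n+1 obtained by adjoining a new minimum and maximum to (P⁻ ∗ T_{t,n})₋ (respectively to P̄ ∗ T_{t,n−1}). Then for every g ∈ G: β_Q([n])(g) = Σ_{S ⊆ [n]} β_P(S)(g) · Σ_{S ⊆ T ⊆ [n]} (−1)^{n−|T|} φ_t(T), and β_R([n])(g) = Σ_{S ⊆ [n]} β_P(S)(g) · Σ_{S ⊆ T ⊆ [n]} (−1)^{n−|T|} ψ_t(T). -/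
/-!
STATEMENT 9: Let n ≥ 1, P a finite bounded graded poset of rank n+1 with a finite group G
acting by order-preserving bijections, t a positive integer, Q (resp. R) the bounded graded
poset of rank n+1 obtained by adjoining a new minimum and maximum to (P⁻ ∗ T_{t,n})₋
(resp. to P̄ ∗ T_{t,n−1}).  Then for every g ∈ G:
β_Q([n])(g) = Σ_{S ⊆ [n]} β_P(S)(g) · Σ_{S ⊆ T ⊆ [n]} (−1)^{n−|T|} φ_t(T), and
β_R([n])(g) = Σ_{S ⊆ [n]} β_P(S)(g) · Σ_{S ⊆ T ⊆ [n]} (−1)^{n−|T|} ψ_t(T).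
-/

noncomputable section

/-- The number of maximal chains of the subposet of `(X, r)` induced on `A`, all of whose
elements satisfy the predicate `fix`.  A maximal chain of the subposet on `A` is a chain
`C ⊆ A` not properly contained in any other chain contained in `A`. -/
def nFixedMaxChains {X : Type} (r : X → X → Prop) (A : Set X) (fix : X → Prop) : ℕ :=
  Nat.card {C : Set X // C ⊆ A ∧ IsChain r C ∧
    (∀ C' : Set X, C' ⊆ A → IsChain r C' → C ⊆ C' → C' = C) ∧ ∀ x ∈ C, fix x}

/-- `α_P(S)(g)`: the number of maximal chains of the rank-selected subposet
`P_S = {x ∈ P : rk x ∈ S} ∪ {⊥, ⊤}` that are fixed pointwise by `g`. -/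
def alphaP (P : Type) [PartialOrder P] [BoundedOrder P]
    (G : Type) [Group G] [MulAction G P] (rk : P → ℕ) (S : Finset ℕ) (g : G) : ℕ :=
  nFixedMaxChains (· ≤ · : P → P → Prop) {x : P | rk x ∈ S ∨ x = ⊥ ∨ x = ⊤}
    (fun x => g • x = x)

/-- `β_P(S)(g) = Σ_{T ⊆ S} (−1)^{|S∖T|} α_P(T)(g)`. -/
def betaP (P : Type) [PartialOrder P] [BoundedOrder P]
    (G : Type) [Group G] [MulAction G P] (rk : P → ℕ) (S : Finset ℕ) (g : G) : ℤ :=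
  ∑ T ∈ S.powerset, (-1 : ℤ) ^ ((S \ T).card) * (alphaP P G rk T g : ℤ)

/-- The Rees-product order relation on pairs `(p, q)` of an element of `P` and a word `q`
(an element of `T_{t,·}`, ranked by its length): `(p₁,q₁) ⪯ (p₂,q₂)` iff `p₁ ≤ p₂`, `q₁` is
a prefix of `q₂`, and `rk p₂ − rk p₁ ≥ length q₂ − length q₁` (stated additively). -/
def reesLe (P : Type) [PartialOrder P] (rk : P → ℕ) {t : ℕ}
    (a b : P × List (Fin t)) : Prop :=
  a.1 ≤ b.1 ∧ a.2 <+: b.2 ∧ rk a.1 + b.2.length ≤ rk b.1 + a.2.length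

/-- The underlying type of `(P⁻ ∗ T_{t,n})₋`: pairs `(p, q)` with `p ≠ ⊤`, `q` a word of
length ≤ n over a `t`-letter alphabet with `length q ≤ rk p`, the minimum `(⊥, [])` removed. -/
abbrev QCore (P : Type) [PartialOrder P] [BoundedOrder P] (rk : P → ℕ) (t n : ℕ) : Type :=
  {pq : P × List (Fin t) // pq.1 ≠ ⊤ ∧ pq.2.length ≤ n ∧ pq.2.length ≤ rk pq.1 ∧
    ¬(pq.1 = ⊥ ∧ pq.2 = [])}

/-- The poset `Q` obtained from `(P⁻ ∗ T_{t,n})₋` by adjoining a new minimum (`none`) and a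
new maximum (`some none`). -/
abbrev QType (P : Type) [PartialOrder P] [BoundedOrder P] (rk : P → ℕ) (t n : ℕ) : Type :=
  Option (Option (QCore P rk t n))

/-- The order relation of `Q`. -/
def QLe (P : Type) [PartialOrder P] [BoundedOrder P] (rk : P → ℕ) (t n : ℕ) :
    QType P rk t n → QType P rk t n → Prop
  | none, _ => True
  | some none, b => b = some none
  | some (some _), none => False
  | some (some _), some none => True
  | some (some c), some (some c') => reesLe P rk c.val c'.val

/-- The rank function of `Q` (a bounded graded poset of rank `n+1`). -/
def QRank (P : Type) [PartialOrder P] [BoundedOrder P] (rk : P → ℕ) (t n : ℕ) :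
    QType P rk t n → ℕ
  | none => 0
  | some none => n + 1
  | some (some c) => rk c.val.1

/-- The fixed-point predicate on `Q` for the induced `G`-action `g • (p, q) = (g • p, q)`:
the new minimum and maximum are fixed, and a core element `(p,q)` is fixed iff `g • p = p`. -/
def QFix (P : Type) [PartialOrder P] [BoundedOrder P]
    (G : Type) [Group G] [MulAction G P] (rk : P → ℕ) (t n : ℕ) (g : G) :
    QType P rk t n → Prop
  | some (some c) => g • c.val.1 = c.val.1
  | _ => True

/-- `α_Q(S)(g)` for the poset `Q`. -/
def alphaQ (P : Type) [PartialOrder P] [BoundedOrder P]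
    (G : Type) [Group G] [MulAction G P] (rk : P → ℕ) (t n : ℕ) (S : Finset ℕ) (g : G) : ℕ :=
  nFixedMaxChains (QLe P rk t n)
    {x : QType P rk t n | QRank P rk t n x ∈ S ∨ x = none ∨ x = some none}
    (QFix P G rk t n g)

/-- `β_Q(S)(g)`. -/
def betaQ (P : Type) [PartialOrder P] [BoundedOrder P]
    (G : Type) [Group G] [MulAction G P] (rk : P → ℕ) (t n : ℕ) (S : Finset ℕ) (g : G) : ℤ :=
  ∑ T ∈ S.powerset, (-1 : ℤ) ^ ((S \ T).card) * (alphaQ P G rk t n T g : ℤ)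

/-- The underlying type of `P̄ ∗ T_{t,n−1}`: pairs `(p, q)` with `⊥ ≠ p ≠ ⊤`, `q` a word of
length ≤ n−1 over a `t`-letter alphabet with `length q ≤ rk p − 1` (the rank of `p` in `P̄`
being `rk p − 1`, stated additively). -/
abbrev RCore (P : Type) [PartialOrder P] [BoundedOrder P] (rk : P → ℕ) (t n : ℕ) : Type :=
  {pq : P × List (Fin t) // pq.1 ≠ ⊤ ∧ pq.1 ≠ ⊥ ∧ pq.2.length ≤ n - 1 ∧
    pq.2.length + 1 ≤ rk pq.1}

/-- The poset `R` obtained from `P̄ ∗ T_{t,n−1}` by adjoining a new minimum (`none`) and a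
new maximum (`some none`). -/
abbrev RType (P : Type) [PartialOrder P] [BoundedOrder P] (rk : P → ℕ) (t n : ℕ) : Type :=
  Option (Option (RCore P rk t n))

/-- The order relation of `R`. -/
def RLe (P : Type) [PartialOrder P] [BoundedOrder P] (rk : P → ℕ) (t n : ℕ) :
    RType P rk t n → RType P rk t n → Prop
  | none, _ => True
  | some none, b => b = some none
  | some (some _), none => False
  | some (some _), some none => True
  | some (some c), some (some c') => reesLe P rk c.val c'.val

/-- The rank function of `R` (a bounded graded poset of rank `n+1`): the new minimum has
rank 0, the new maximum rank `n+1`, and a core element `(p,q)` has rank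
`(rk p − 1) + 1 = rk p`. -/
def RRank (P : Type) [PartialOrder P] [BoundedOrder P] (rk : P → ℕ) (t n : ℕ) :
    RType P rk t n → ℕ
  | none => 0
  | some none => n + 1
  | some (some c) => rk c.val.1

/-- The fixed-point predicate on `R` for the induced `G`-action `g • (p, q) = (g • p, q)`:
the new minimum and maximum are fixed, and a core element `(p,q)` is fixed iff `g • p = p`. -/
def RFix (P : Type) [PartialOrder P] [BoundedOrder P]
    (G : Type) [Group G] [MulAction G P] (rk : P → ℕ) (t n : ℕ) (g : G) :
    RType P rk t n → Prop
  | some (some c) => g • c.val.1 = c.val.1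
  | _ => True

/-- `α_R(S)(g)` for the poset `R`. -/
def alphaR (P : Type) [PartialOrder P] [BoundedOrder P]
    (G : Type) [Group G] [MulAction G P] (rk : P → ℕ) (t n : ℕ) (S : Finset ℕ) (g : G) : ℕ :=
  nFixedMaxChains (RLe P rk t n)
    {x : RType P rk t n | RRank P rk t n x ∈ S ∨ x = none ∨ x = some none}
    (RFix P G rk t n g)

/-- `β_R(S)(g)`. -/
def betaR (P : Type) [PartialOrder P] [BoundedOrder P]
    (G : Type) [Group G] [MulAction G P] (rk : P → ℕ) (t n : ℕ) (S : Finset ℕ) (g : G) : ℤ :=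
  ∑ T ∈ S.powerset, (-1 : ℤ) ^ ((S \ T).card) * (alphaR P G rk t n T g : ℤ)


/-- `ψ_t(T) = [s₁]_t [s₂−s₁+1]_t ⋯ [s_k−s_{k−1}+1]_t` for `T = {s₁ < s₂ < ⋯ < s_k}`,
with `ψ_t(∅) = 1`. -/
def psi (T : Finset ℕ) : Polynomial ℤ :=
  match T.sort (· ≤ ·) with
  | [] => 1
  | s :: rest => qt s * phiAux s rest

/-- A partial order `r` with least element `b` and greatest element `e`, graded of rank `n + 1`
by `ρ`, the gradedness being expressed by interpolation of ranks. -/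
structure BoundedRankedRel {X : Type} (r : X → X → Prop) (ρ : X → ℕ) (b e : X) (n : ℕ) :
    Prop where
  refl : ∀ x, r x x
  trans : ∀ {x y z}, r x y → r y z → r x z
  rank_lt : ∀ {x y}, r x y → x ≠ y → ρ x < ρ y
  bot_rel : ∀ x, r b x
  rel_top : ∀ x, r x e
  rank_bot : ρ b = 0
  rank_top : ρ e = n + 1
  interpolate : ∀ {x y s}, r x y → ρ x < s → s < ρ y → ∃ z, r x z ∧ r z y ∧ ρ z = s

/-- Chains above `x`, as lists, running through fixed elements of the ranks listed in `L`. -/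
def rankChains {X : Type} (r : X → X → Prop) (ρ : X → ℕ) (fix : X → Prop) (x : X) (L : List ℕ) :
    Set (List X) :=
  {l | l.map ρ = L ∧ (x :: l).IsChain r ∧ ∀ y ∈ l, fix y}

namespace BoundedRankedRel

variable {X : Type} {r : X → X → Prop} {ρ : X → ℕ} {b e : X} {n : ℕ}

theorem eq_of_mem_chain (h : BoundedRankedRel r ρ b e n) {C : Set X} (hC : IsChain r C) {x y : X}
    (hx : x ∈ C) (hy : y ∈ C) (hxy : ρ x = ρ y) : x = y := by
  by_contra hne
  rcases hC hx hy hne with h1 | h1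
  · exact absurd (h.rank_lt h1 hne) (by omega)
  · exact absurd (h.rank_lt h1 (Ne.symm hne)) (by omega)

theorem rel_of_mem_chain (h : BoundedRankedRel r ρ b e n) {C : Set X} (hC : IsChain r C) {x y : X}
    (hx : x ∈ C) (hy : y ∈ C) (hxy : ρ x < ρ y) : r x y := by
  have hne : x ≠ y := by rintro rfl; omega
  rcases hC hx hy hne with h1 | h1
  · exact h1
  · exact absurd (h.rank_lt h1 (Ne.symm hne)) (by omega)

/-- A maximal chain of a rank-selected subposet contains the bounds and meets every selected
rank. -/
theorem mem_of_maximal (h : BoundedRankedRel r ρ b e n) {T : Finset ℕ}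
    (hT : T ⊆ Finset.Icc 1 n) {C : Set X} (hCA : C ⊆ {x | ρ x ∈ T ∨ x = b ∨ x = e})
    (hC : IsChain r C)
    (hmax : ∀ C' : Set X, C' ⊆ {x | ρ x ∈ T ∨ x = b ∨ x = e} → IsChain r C' → C ⊆ C' → C' = C) :
    b ∈ C ∧ e ∈ C ∧ ∀ s ∈ T, ∃ x ∈ C, ρ x = s := by
  have key : ∀ z, (ρ z ∈ T ∨ z = b ∨ z = e) → (∀ y ∈ C, r z y ∨ r y z) → z ∈ C := by
    intro z hz hcomp
    rw [← hmax (insert z C) (Set.insert_subset hz hCA)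
      (hC.insert fun y hy _ => hcomp y hy) (Set.subset_insert z C)]
    exact Set.mem_insert z C
  have hb : b ∈ C := key b (by simp) fun y _ => Or.inl (h.bot_rel y)
  have he : e ∈ C := key e (by simp) fun y _ => Or.inr (h.rel_top y)
  refine ⟨hb, he, fun s hs => ?_⟩
  by_contra! hno
  have hs1 := Finset.mem_Icc.1 (hT hs)
  obtain ⟨x, ⟨hxC, hxs⟩, hxmax⟩ : ∃ x, (x ∈ C ∧ ρ x < s) ∧ ∀ y, y ∈ C ∧ ρ y < s → ρ y ≤ ρ x := by
    have hne : ∃ k, k < s ∧ ∃ x ∈ C, ρ x = s - 1 - k :=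
      ⟨s - 1, by omega, b, hb, by rw [h.rank_bot]; omega⟩
    classical
    obtain ⟨hk, x, hxC, hx⟩ := Nat.find_spec hne
    refine ⟨x, ⟨hxC, by omega⟩, fun y hy => ?_⟩
    have := Nat.find_min' hne (m := s - 1 - ρ y) ⟨by omega, y, hy.1, by omega⟩
    omega
  obtain ⟨y, ⟨hyC, hys⟩, hymin⟩ : ∃ y, (y ∈ C ∧ s < ρ y) ∧ ∀ z, z ∈ C ∧ s < ρ z → ρ y ≤ ρ z := by
    have hne : ∃ k, s < k ∧ ∃ x ∈ C, ρ x = k := ⟨n + 1, by omega, e, he, h.rank_top⟩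
    classical
    obtain ⟨hk, x, hxC, hx⟩ := Nat.find_spec hne
    refine ⟨x, ⟨hxC, by omega⟩, fun y hy => ?_⟩
    rw [hx]
    exact Nat.find_min' hne ⟨hy.2, y, hy.1, rfl⟩
  obtain ⟨z, hxz, hzy, hz⟩ := h.interpolate (h.rel_of_mem_chain hC hxC hyC (by omega)) hxs hys
  refine hno z (key z (Or.inl (hz ▸ hs)) fun w hw => ?_) hz
  rcases lt_or_gt_of_ne (hno w hw) with hlt | hgt
  · right
    rcases (hxmax w ⟨hw, hlt⟩).eq_or_lt with heq | hlt'
    · rwa [h.eq_of_mem_chain hC hw hxC heq]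
    · exact h.trans (h.rel_of_mem_chain hC hw hxC hlt') hxz
  · left
    rcases (hymin w ⟨hw, hgt⟩).eq_or_lt with heq | hlt'
    · rwa [← h.eq_of_mem_chain hC hyC hw heq]
    · exact h.trans hzy (h.rel_of_mem_chain hC hyC hw hlt')

/-- Maximal chains of a rank-selected subposet correspond to the lists of their elements of
selected rank. -/
theorem nFixedMaxChains_eq (h : BoundedRankedRel r ρ b e n) {fix : X → Prop} (hfb : fix b)
    (hfe : fix e) {T : Finset ℕ} (hT : T ⊆ Finset.Icc 1 n) :
    nFixedMaxChains r {x | ρ x ∈ T ∨ x = b ∨ x = e} fix =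
      (rankChains r ρ fix b (T.sort (· ≤ ·))).ncard := by
  have : Trans r r r := ⟨h.trans⟩
  have hrank : ∀ {l : List X}, l.map ρ = T.sort (· ≤ ·) → ∀ x ∈ l, ρ x ∈ T := by
    intro l hl x hx
    rw [← Finset.mem_sort (α := ℕ) (· ≤ ·), ← hl]
    exact List.mem_map_of_mem hx
  have hlt : ∀ {l : List X}, l.map ρ = T.sort (· ≤ ·) → l.Pairwise fun x y => ρ x < ρ y := by
    intro l hl
    rw [← List.pairwise_map (f := ρ) (R := (· < ·)), hl]
    exact (Finset.sortedLT_sort T).pairwise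
  have hmem : ∀ {l : List X}, l.map ρ = T.sort (· ≤ ·) → ∀ x,
      x ∈ l ↔ (x ∈ l ∨ x = b ∨ x = e) ∧ ρ x ∈ T := by
    intro l hl x
    refine ⟨fun hx => ⟨Or.inl hx, hrank hl x hx⟩, ?_⟩
    rintro ⟨hx | rfl | rfl, hxT⟩
    · exact hx
    · have := Finset.mem_Icc.1 (hT hxT)
      have := h.rank_bot
      omega
    · have := Finset.mem_Icc.1 (hT hxT)
      have := h.rank_top
      omega
  unfold nFixedMaxChains
  rw [← Nat.card_coe_set_eq]
  symm
  refine Nat.card_congr (Equiv.ofBijective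
    (fun l => ⟨{x | x ∈ l.1 ∨ x = b ∨ x = e}, ?_, ?_, ?_, ?_⟩) ⟨?_, ?_⟩)
  · rintro x (hx | hx)
    · exact Or.inl (hrank l.2.1 x hx)
    · exact Or.inr hx
  · have hp := (List.pairwise_cons.1 (List.isChain_iff_pairwise.1 l.2.2.1)).2
    have hall : ∀ x ∈ l.1, ∀ y ∈ l.1, x ≠ y → r x y ∨ r y x := by
      intro x hx y hy hne
      have hp' : l.1.Pairwise fun x y => r x y ∨ r y x := hp.imp Or.inl
      have : Std.Symm fun x y => r x y ∨ r y x := ⟨fun _ _ => Or.symm⟩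
      exact hp'.forall hx hy hne
    rintro x (hx | rfl | rfl) y (hy | rfl | rfl) hne
    · exact hall x hx y hy hne
    all_goals first
      | exact Or.inl (h.bot_rel _)
      | exact Or.inr (h.bot_rel _)
      | exact Or.inl (h.rel_top _)
      | exact Or.inr (h.rel_top _)
  · intro C' hA hC' hsub
    refine Set.Subset.antisymm (fun x hx => ?_) hsub
    rcases hA hx with hxT | hx'
    · rw [← Finset.mem_sort (α := ℕ) (· ≤ ·), ← l.2.1, List.mem_map] at hxT
      obtain ⟨y, hy, hyx⟩ := hxT
      rw [← h.eq_of_mem_chain hC' (hsub (Or.inl hy)) hx hyx]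
      exact Or.inl hy
    · exact Or.inr hx'
  · rintro x (hx | rfl | rfl)
    · exact l.2.2.2 x hx
    · exact hfb
    · exact hfe
  · intro l l' hll
    have heq := congrArg Subtype.val hll
    simp only at heq
    have hiff : ∀ x, x ∈ l.1 ↔ x ∈ l'.1 := by
      intro x
      rw [hmem l.2.1, hmem l'.2.1]
      exact and_congr_left fun _ => Set.ext_iff.1 heq x
    have hnd : ∀ {m : List X}, m.map ρ = T.sort (· ≤ ·) → m.Nodup := fun hm =>
      (hlt hm).imp fun {x y} hxy => by rintro rfl; exact lt_irrefl _ hxy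
    apply Subtype.ext
    refine List.Perm.eq_of_pairwise (le := fun x y => ρ x < ρ y) ?_ (hlt l.2.1) (hlt l'.2.1)
      ((List.perm_ext_iff_of_nodup (hnd l.2.1) (hnd l'.2.1)).2 hiff)
    intro x y _ _ h1 h2
    exact absurd h1 (by omega)
  · rintro ⟨C, hCA, hC, hmax, hfix⟩
    obtain ⟨hb, he, hs⟩ := h.mem_of_maximal hT hCA hC hmax
    have hs' : ∀ s, ∃ x, s ∈ T → x ∈ C ∧ ρ x = s := by
      intro s
      by_cases hsT : s ∈ T
      · obtain ⟨x, hx⟩ := hs s hsT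
        exact ⟨x, fun _ => hx⟩
      · exact ⟨b, fun h => absurd h hsT⟩
    choose f hf using hs'
    have hfC : ∀ y ∈ (T.sort (· ≤ ·)).map f, y ∈ C := by
      intro y hy
      obtain ⟨s, hs, rfl⟩ := List.mem_map.1 hy
      exact (hf s ((Finset.mem_sort _).1 hs)).1
    refine ⟨⟨(T.sort (· ≤ ·)).map f, ?_, ?_, ?_⟩, ?_⟩
    · rw [List.map_map]
      refine (List.map_congr_left fun s hs => ?_).trans (List.map_id _)
      exact (hf s ((Finset.mem_sort _).1 hs)).2
    · rw [List.isChain_iff_pairwise, List.pairwise_cons, List.pairwise_map]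
      refine ⟨fun y _ => h.bot_rel y, ?_⟩
      refine (Finset.sortedLT_sort T).pairwise.imp_of_mem fun {s s'} hs hs' hss => ?_
      have h1 := hf s ((Finset.mem_sort _).1 hs)
      have h2 := hf s' ((Finset.mem_sort _).1 hs')
      exact h.rel_of_mem_chain hC h1.1 h2.1 (by omega)
    · exact fun y hy => hfix y (hfC y hy)
    · apply Subtype.ext
      refine Set.Subset.antisymm ?_ fun x hx => ?_
      · rintro x (hx | rfl | rfl)
        · exact hfC x hx
        · exact hb
        · exact he
      · rcases hCA hx with hxT | hx'
        · left
          rw [← h.eq_of_mem_chain hC (hf _ hxT).1 hx (hf _ hxT).2]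
          exact List.mem_map_of_mem ((Finset.mem_sort _).2 hxT)
        · exact Or.inr hx'

end BoundedRankedRel

section rankChains

variable {X : Type} {r : X → X → Prop} {ρ : X → ℕ} {fix : X → Prop}

theorem ncard_rankChains_nil (x : X) : (rankChains r ρ fix x []).ncard = 1 := by
  rw [Set.ncard_eq_one]
  refine ⟨[], Set.ext fun l => ?_⟩
  simp only [rankChains, Set.mem_ofPred_eq, Set.mem_singleton_iff, List.map_eq_nil_iff]
  constructor
  · exact fun h => h.1
  · rintro rfl
    simp

theorem finite_rankChains [Finite X] (x : X) (L : List ℕ) : (rankChains r ρ fix x L).Finite :=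
  (List.finite_length_eq X L.length).subset fun l hl => by
    rw [Set.mem_ofPred_eq, ← hl.1, List.length_map]

open Classical in
theorem ncard_rankChains_cons [Fintype X] (x : X) (s : ℕ) (L : List ℕ) :
    (rankChains r ρ fix x (s :: L)).ncard =
      ∑ y with r x y ∧ ρ y = s ∧ fix y, (rankChains r ρ fix y L).ncard := by
  have hfin (y : X) : Finite (rankChains r ρ fix y L) := finite_rankChains y L
  rw [Finset.sum_subtype _ (p := fun y => r x y ∧ ρ y = s ∧ fix y) (by simp)]
  simp_rw [← Nat.card_coe_set_eq]
  rw [← Nat.card_sigma]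
  symm
  refine Nat.card_congr (Equiv.ofBijective (fun p => ⟨p.1.1 :: p.2.1, ?_, ?_, ?_⟩) ⟨?_, ?_⟩)
  · rw [List.map_cons, p.1.2.2.1, p.2.2.1]
  · exact List.isChain_cons_cons.2 ⟨p.1.2.1, p.2.2.2.1⟩
  · exact List.forall_mem_cons.2 ⟨p.1.2.2.2, p.2.2.2.2⟩
  · rintro ⟨⟨y, hy⟩, l, hl⟩ ⟨⟨y', hy'⟩, l', hl'⟩ heq
    obtain ⟨rfl, rfl⟩ := List.cons.inj (congrArg Subtype.val heq)
    rfl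
  · rintro ⟨l, hl, hc, hf⟩
    cases l with
    | nil => simp at hl
    | cons y l =>
      simp only [List.map_cons, List.cons.injEq] at hl
      have hc' := List.isChain_cons_cons.1 hc
      have hf' := List.forall_mem_cons.1 hf
      exact ⟨⟨⟨y, hc'.1, hl.1, hf'.1⟩, l, hl.2, hc'.2, hf'.2⟩, rfl⟩

end rankChains

section words

theorem ncard_words_lt (t m : ℕ) :
    ({w : List (Fin t) | w.length < m}.ncard : ℤ) = (qt m).eval (t : ℤ) := by
  have key : {w : List (Fin t) | w.length < m}.ncard = ∑ i ∈ Finset.range m, t ^ i := by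
    induction m with
    | zero => simp
    | succ m ih =>
      have hunion : {w : List (Fin t) | w.length < m + 1} =
          {w | w.length < m} ∪ {w | w.length = m} := by
        ext w
        exact Nat.lt_succ_iff_lt_or_eq
      rw [hunion, Set.ncard_union_eq
        (Set.disjoint_left.2 fun w h1 h2 => by simp_all)
        (List.finite_length_lt _ _) (List.finite_length_eq _ _), ih, Finset.sum_range_succ,
        ← Nat.card_coe_set_eq {w : List (Fin t) | w.length = m}]
      congr 1
      change Nat.card (List.Vector (Fin t) m) = _
      rw [Nat.card_eq_fintype_card, card_vector, Fintype.card_fin]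
  rw [key, qt, Polynomial.eval_finsetSum]
  simp

/-- A word over `t` letters has `[m]_t` extensions by fewer than `m` letters. -/
theorem ncard_extensions (t m : ℕ) (q : List (Fin t)) :
    ({w : List (Fin t) | q <+: w ∧ w.length < q.length + m}.ncard : ℤ) =
      (qt m).eval (t : ℤ) := by
  rw [← ncard_words_lt, ← Set.ncard_image_of_injective {w : List (Fin t) | w.length < m}
    (List.append_right_injective q)]
  congr 2
  ext w
  constructor
  · rintro ⟨⟨v, rfl⟩, hlt⟩
    exact ⟨v, by simpa using hlt, rfl⟩
  · rintro ⟨v, hv, rfl⟩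
    exact ⟨List.prefix_append q v, by simpa using hv⟩

end words

section augment

variable {Y : Type}

/-- The relation `le` with a new minimum `none` and a new maximum `some none` adjoined. -/
def augLe (le : Y → Y → Prop) : Option (Option Y) → Option (Option Y) → Prop
  | none, _ => True
  | some none, b => b = some none
  | some (some _), none => False
  | some (some _), some none => True
  | some (some c), some (some c') => le c c'

/-- The rank function after adjoining a new minimum and a new maximum of rank `n + 1`. -/
def augRank (n : ℕ) (f : Y → ℕ) : Option (Option Y) → ℕ
  | none => 0
  | some none => n + 1
  | some (some c) => f c

/-- A predicate extended to hold at the new minimum and maximum. -/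
def augFix (fix : Y → Prop) : Option (Option Y) → Prop
  | some (some c) => fix c
  | _ => True

end augment

section gradedPoset

variable {P : Type} [Fintype P] [PartialOrder P] {rk : P → ℕ} {n : ℕ}

theorem strictMono_of_graded (hgraded : ∀ x y : P, x ⋖ y → rk y = rk x + 1) : StrictMono rk := by
  classical
  have : LocallyFiniteOrder P := Fintype.toLocallyFiniteOrder
  rw [strictMono_iff_forall_covBy]
  intro x y hxy
  rw [hgraded x y hxy]
  exact Nat.lt_succ_self _

theorem exists_rank_eq_of_graded (hgraded : ∀ x y : P, x ⋖ y → rk y = rk x + 1) {x y : P} {s : ℕ}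
    (hxy : x ≤ y) (hx : rk x ≤ s) (hy : s ≤ rk y) : ∃ z, x ≤ z ∧ z ≤ y ∧ rk z = s := by
  classical
  have : LocallyFiniteOrder P := Fintype.toLocallyFiniteOrder
  obtain ⟨z, hz⟩ := (Set.toFinite {z | x ≤ z ∧ z ≤ y ∧ rk z ≤ s}).exists_maximal
    ⟨x, le_rfl, hxy, hx⟩
  obtain ⟨hxz, hzy, hzs⟩ := hz.prop
  refine ⟨z, hxz, hzy, hzs.eq_or_lt.resolve_right fun hlt => ?_⟩
  have hzy' : z < y := lt_of_le_of_ne hzy (by rintro rfl; omega)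
  obtain ⟨w, hzw, hwy⟩ := exists_covBy_le_of_lt hzy'
  exact hzw.lt.not_ge (hz.le_of_ge ⟨hxz.trans hzw.le, hwy, by rw [hgraded z w hzw]; omega⟩ hzw.le)

theorem boundedRankedRel_le [BoundedOrder P] (hrk_bot : rk ⊥ = 0) (hrk_top : rk ⊤ = n + 1)
    (hgraded : ∀ x y : P, x ⋖ y → rk y = rk x + 1) :
    BoundedRankedRel (· ≤ · : P → P → Prop) rk ⊥ ⊤ n where
  refl := le_refl
  trans := le_trans
  rank_lt hxy hne := strictMono_of_graded hgraded (lt_of_le_of_ne hxy hne)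
  bot_rel _ := bot_le
  rel_top _ := le_top
  rank_bot := hrk_bot
  rank_top := hrk_top
  interpolate hxy hx hy := exists_rank_eq_of_graded hgraded hxy hx.le hy.le

end gradedPoset

section rees

variable {P : Type} [Fintype P] [PartialOrder P] [BoundedOrder P] {rk : P → ℕ} {n t d : ℕ}
  {pr : P × List (Fin t) → Prop}

theorem boundedRankedRel_rees (hrk_bot : rk ⊥ = 0) (hrk_top : rk ⊤ = n + 1)
    (hgraded : ∀ x y : P, x ⋖ y → rk y = rk x + 1) (hd : d ≤ 1)
    (hpr : ∀ pq, pr pq ↔ pq.1 ≠ ⊤ ∧ pq.1 ≠ ⊥ ∧ pq.2.length + d ≤ rk pq.1) :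
    BoundedRankedRel (augLe fun c c' : {pq // pr pq} => reesLe P rk c.val c'.val)
      (augRank n fun c => rk c.val.1) none (some none) n := by
  have hmono := strictMono_of_graded hgraded
  have hpos : ∀ p : P, p ≠ ⊥ → 0 < rk p := fun p hp => by
    rw [← hrk_bot]
    exact hmono (bot_lt_iff_ne_bot.2 hp)
  have hltn : ∀ p : P, p ≠ ⊤ → rk p < n + 1 := fun p hp => by
    rw [← hrk_top]
    exact hmono (lt_top_iff_ne_top.2 hp)
  have hne : ∀ p : P, 0 < rk p → rk p < n + 1 → p ≠ ⊤ ∧ p ≠ ⊥ := fun p h1 h2 =>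
    ⟨by rintro rfl; omega, by rintro rfl; omega⟩
  refine ⟨?_, ?_, ?_, ?_, ?_, rfl, rfl, ?_⟩
  · rintro (_ | _ | c)
    exacts [trivial, rfl, ⟨le_rfl, List.prefix_rfl, le_rfl⟩]
  · rintro (_ | _ | ⟨⟨p, q⟩, hc⟩) (_ | _ | ⟨⟨p', q'⟩, hc'⟩) (_ | _ | ⟨⟨p'', q''⟩, hc''⟩) h1 h2 <;>
      simp only [augLe, reesLe, reduceCtorEq, Option.some.injEq] at h1 h2 ⊢
    exact ⟨h1.1.trans h2.1, h1.2.1.trans h2.2.1, by omega⟩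
  · rintro (_ | _ | ⟨⟨p, q⟩, hc⟩) (_ | _ | ⟨⟨p', q'⟩, hc'⟩) h1 h2 <;>
      simp only [augLe, augRank, reesLe, reduceCtorEq, Option.some.injEq, ne_eq,
        not_true_eq_false] at h1 h2 ⊢
    · omega
    · exact hpos _ ((hpr _).1 hc').2.1
    · exact hltn _ ((hpr _).1 hc).1
    · rcases h1.1.eq_or_lt with rfl | hlt
      · obtain rfl := h1.2.1.eq_of_length_le (by omega)
        exact absurd rfl h2
      · exact hmono hlt
  · rintro (_ | _ | c) <;> trivial
  · rintro (_ | _ | c) <;> trivial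
  · rintro (_ | _ | ⟨⟨p, q⟩, hc⟩) (_ | _ | ⟨⟨p', q'⟩, hc'⟩) s h1 hxs hsy <;>
      simp only [augLe, augRank, reesLe, reduceCtorEq, Option.some.injEq, not_lt_zero] at h1 hxs hsy
    · obtain ⟨z, -, -, hz⟩ := exists_rank_eq_of_graded hgraded (bot_le : ⊥ ≤ (⊤ : P))
        (s := s) (by omega) (by omega)
      have hz' := hne z (by omega) (by omega)
      exact ⟨some (some ⟨(z, []), (hpr _).2 ⟨hz'.1, hz'.2, by simp; omega⟩⟩), trivial, trivial, hz⟩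
    · obtain ⟨z, -, hzp, hz⟩ := exists_rank_eq_of_graded hgraded (bot_le : ⊥ ≤ p')
        (s := s) (by omega) (by omega)
      have hc2 := (hpr _).1 hc'
      have hz' := hne z (by omega) (by have := hltn _ hc2.1; simp only at this; omega)
      have hlen := hc2.2.2
      simp only at hlen
      refine ⟨some (some ⟨(z, q'.take (s - d)), (hpr _).2 ⟨hz'.1, hz'.2, ?_⟩⟩), trivial,
        ⟨hzp, List.take_prefix _ _, ?_⟩, hz⟩ <;>
      simp only [List.length_take] <;> omega
    · omega
    · obtain ⟨z, hpz, -, hz⟩ := exists_rank_eq_of_graded hgraded (le_top : p ≤ ⊤)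
        (s := s) (by omega) (by omega)
      have hc2 := (hpr _).1 hc
      have hz' := hne z (by omega) (by omega)
      have hlen := hc2.2.2
      simp only at hlen
      exact ⟨some (some ⟨(z, q), (hpr _).2 ⟨hz'.1, hz'.2, by simp only; omega⟩⟩),
        ⟨hpz, List.prefix_rfl, by simp only; omega⟩, trivial, hz⟩
    · obtain ⟨z, hpz, hzp, hz⟩ := exists_rank_eq_of_graded hgraded h1.1 (s := s)
        (by omega) (by omega)
      obtain ⟨-, hpre, hlen'⟩ := h1
      have hc2 := (hpr _).1 hc
      have hc2' := (hpr _).1 hc'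
      have hz' := hne z (by omega) (by have := hltn _ hc2'.1; simp only at this; omega)
      have hlen := hc2.2.2
      have hpl := hpre.length_le
      simp only at hlen
      refine ⟨some (some ⟨(z, q'.take (q.length + (s - rk p))), (hpr _).2 ⟨hz'.1, hz'.2, ?_⟩⟩),
        ⟨hpz, ?_, ?_⟩, ⟨hzp, List.take_prefix _ _, ?_⟩, hz⟩
      · simp only [List.length_take]; omega
      · rw [List.prefix_take_iff]
        exact ⟨hpre, Nat.le_add_right _ _⟩
      · change rk p + (q'.take (q.length + (s - rk p))).length ≤ rk z + q.length
        simp only [List.length_take]; omega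
      · simp only [List.length_take]; omega

theorem finite_reesCore (hpr : ∀ pq, pr pq ↔ pq.1 ≠ ⊤ ∧ pq.1 ≠ ⊥ ∧ pq.2.length + d ≤ rk pq.1) :
    Finite {pq // pr pq} := by
  obtain ⟨N, hN⟩ := (Set.finite_range rk).bddAbove
  refine ((Set.finite_univ.prod (List.finite_length_le (Fin t) N)).subset ?_ : {pq | pr pq}.Finite)
  intro pq hpq
  have h1 := ((hpr pq).1 hpq).2.2
  have h2 := hN (Set.mem_range_self pq.1)
  exact ⟨trivial, show pq.2.length ≤ N by omega⟩

/-- One step of the count of chains in a Rees product: there are `[m]_t` choices of the next word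
for each choice of the next element of `P`. -/
theorem ncard_rankChains_rees_cons [Fintype {pq // pr pq}]
    (hpr : ∀ pq, pr pq ↔ pq.1 ≠ ⊤ ∧ pq.1 ≠ ⊥ ∧ pq.2.length + d ≤ rk pq.1)
    (hrk_bot : rk ⊥ = 0) (hrk_top : rk ⊤ = n + 1) (fix : P → Prop)
    {x : Option (Option {pq // pr pq})} {p : P} {q : List (Fin t)} {s m : ℕ} {L : List ℕ} {K : ℤ}
    (hs : 0 < s) (hsn : s ≤ n)
    (hx : ∀ c : {pq // pr pq}, rk c.val.1 = s →
      (augLe (fun c c' : {pq // pr pq} => reesLe P rk c.val c'.val) x (some (some c)) ↔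
        p ≤ c.val.1 ∧ q <+: c.val.2 ∧ c.val.2.length < q.length + m))
    (hqm : q.length + m + d ≤ s + 1)
    (ih : ∀ c : {pq // pr pq}, rk c.val.1 = s →
      ((rankChains (augLe fun c c' : {pq // pr pq} => reesLe P rk c.val c'.val)
        (augRank n fun c => rk c.val.1) (augFix fun c => fix c.val.1) (some (some c)) L).ncard : ℤ)
      = (rankChains (· ≤ ·) rk fix c.val.1 L).ncard * K) :
    ((rankChains (augLe fun c c' : {pq // pr pq} => reesLe P rk c.val c'.val)
        (augRank n fun c => rk c.val.1) (augFix fun c => fix c.val.1) x (s :: L)).ncard : ℤ)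
      = (rankChains (· ≤ ·) rk fix p (s :: L)).ncard * ((qt m).eval (t : ℤ) * K) := by
  classical
  rw [ncard_rankChains_cons, ncard_rankChains_cons]
  push_cast
  let proj : Option (Option {pq // pr pq}) → P
    | some (some c) => c.val.1
    | _ => ⊥
  rw [Finset.sum_mul, ← Finset.sum_fiberwise_of_maps_to (g := proj)
    (t := Finset.univ.filter fun y => p ≤ y ∧ rk y = s ∧ fix y)]
  · refine Finset.sum_congr rfl fun p' hp' => ?_
    obtain ⟨-, hpp', hp's, hfp'⟩ := Finset.mem_filter.1 hp'
    rw [Finset.sum_congr rfl (g := fun _ => ((rankChains (· ≤ ·) rk fix p' L).ncard * K : ℤ)),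
      Finset.sum_const, nsmul_eq_mul, ← ncard_extensions t m q, ← Set.ncard_coe_finset]
    · refine (congrArg (fun k : ℕ => (k : ℤ) * _) (Set.ncard_congr
        (fun w (hw : w ∈ {w : List (Fin t) | q <+: w ∧ w.length < q.length + m}) =>
          (some (some ⟨(p', w), (hpr _).2 ⟨by rintro rfl; omega, by rintro rfl; omega, by
            have := hw.2
            simp only
            omega⟩⟩) : Option (Option {pq // pr pq}))) ?_ ?_ ?_).symm).trans (by ring)
      · intro w hw
        rw [Finset.mem_coe, Finset.mem_filter, Finset.mem_filter]
        exact ⟨⟨Finset.mem_univ _, (hx _ hp's).2 ⟨hpp', hw⟩, hp's, hfp'⟩, rfl⟩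
      · intro w w' hw hw' heq
        simpa using heq
      · rintro (_ | _ | ⟨⟨p'', w⟩, hc⟩) hy <;>
          rw [Finset.mem_coe, Finset.mem_filter, Finset.mem_filter] at hy
        · have := hy.1.2.2.1
          simp only [augRank] at this
          omega
        · have := hy.1.2.2.1
          simp only [augRank] at this
          omega
        · obtain ⟨⟨-, hle, hrk, -⟩, hproj⟩ := hy
          obtain rfl : p'' = p' := hproj
          exact ⟨w, ((hx _ hrk).1 hle).2, rfl⟩
    · rintro (_ | _ | c) hy <;> rw [Finset.mem_filter, Finset.mem_filter] at hy
      · have := hy.1.2.2.1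
        simp only [augRank] at this
        omega
      · have := hy.1.2.2.1
        simp only [augRank] at this
        omega
      · rw [ih c hy.1.2.2.1, ← hy.2]
  · rintro (_ | _ | c) hy <;> rw [Finset.mem_filter] at hy
    · have := hy.2.2.1
      simp only [augRank] at this
      omega
    · have := hy.2.2.1
      simp only [augRank] at this
      omega
    · rw [Finset.mem_filter]
      exact ⟨Finset.mem_univ _, ((hx c hy.2.2.1).1 hy.2.1).1, hy.2.2⟩

theorem ncard_rankChains_rees [Fintype {pq // pr pq}]
    (hpr : ∀ pq, pr pq ↔ pq.1 ≠ ⊤ ∧ pq.1 ≠ ⊥ ∧ pq.2.length + d ≤ rk pq.1)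
    (hrk_bot : rk ⊥ = 0) (hrk_top : rk ⊤ = n + 1) (fix : P → Prop) (L : List ℕ) (s₀ : ℕ)
    (hL : (s₀ :: L).IsChain (· < ·)) (hLn : ∀ s ∈ L, s ≤ n) (c : {pq // pr pq})
    (hc : rk c.val.1 = s₀) :
    ((rankChains (augLe fun c c' : {pq // pr pq} => reesLe P rk c.val c'.val)
        (augRank n fun c => rk c.val.1) (augFix fun c => fix c.val.1) (some (some c)) L).ncard : ℤ)
      = (rankChains (· ≤ ·) rk fix c.val.1 L).ncard * (phiAux s₀ L).eval (t : ℤ) := by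
  induction L generalizing s₀ c with
  | nil => simp [ncard_rankChains_nil, phiAux]
  | cons s L ih =>
    obtain ⟨hs, hL⟩ := List.isChain_cons_cons.1 hL
    have hlen := ((hpr _).1 c.2).2.2
    rw [phiAux, Polynomial.eval_mul]
    refine ncard_rankChains_rees_cons hpr hrk_bot hrk_top fix (q := c.val.2) (by omega)
      (hLn s (by simp)) (fun c' hc' => ?_) (by omega)
      (fun c' hc' => ih s hL (fun u hu => hLn u (by simp [hu])) c' hc')
    simp only [augLe, reesLe]
    refine and_congr_right fun _ => and_congr_right fun _ => ?_
    omega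

/-- The common form of `φ_t` (for `d = 0`) and `ψ_t` (for `d = 1`). -/
def reesWeight (d : ℕ) : List ℕ → Polynomial ℤ
  | [] => 1
  | s :: rest => qt (s + 1 - d) * phiAux s rest

theorem nFixedMaxChains_rees (hrk_bot : rk ⊥ = 0) (hrk_top : rk ⊤ = n + 1)
    (hgraded : ∀ x y : P, x ⋖ y → rk y = rk x + 1) (hd : d ≤ 1)
    (hpr : ∀ pq, pr pq ↔ pq.1 ≠ ⊤ ∧ pq.1 ≠ ⊥ ∧ pq.2.length + d ≤ rk pq.1)
    {fix : P → Prop} (hfb : fix ⊥) (hft : fix ⊤) {T : Finset ℕ} (hT : T ⊆ Finset.Icc 1 n) :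
    (nFixedMaxChains (augLe fun c c' : {pq // pr pq} => reesLe P rk c.val c'.val)
        {x | augRank n (fun c => rk c.val.1) x ∈ T ∨ x = none ∨ x = some none}
        (augFix fun c => fix c.val.1) : ℤ) =
      (nFixedMaxChains (· ≤ · : P → P → Prop) {x | rk x ∈ T ∨ x = ⊥ ∨ x = ⊤} fix) *
        (reesWeight d (T.sort (· ≤ ·))).eval (t : ℤ) := by
  have := finite_reesCore hpr
  have := Fintype.ofFinite {pq // pr pq}
  rw [(boundedRankedRel_rees hrk_bot hrk_top hgraded hd hpr).nFixedMaxChains_eq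
    (fix := augFix fun c => fix c.val.1) trivial trivial hT,
    (boundedRankedRel_le hrk_bot hrk_top hgraded).nFixedMaxChains_eq hfb hft hT]
  have hmem : ∀ s ∈ T.sort (· ≤ ·), 1 ≤ s ∧ s ≤ n := fun s hs =>
    Finset.mem_Icc.1 (hT ((Finset.mem_sort _).1 hs))
  have hsorted := List.isChain_iff_pairwise.2 (Finset.sortedLT_sort T).pairwise
  generalize T.sort (· ≤ ·) = L at hmem hsorted ⊢
  cases L with
  | nil => simp [ncard_rankChains_nil, reesWeight]
  | cons s L =>
    obtain ⟨hs, hsn⟩ := hmem s (by simp)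
    rw [reesWeight, Polynomial.eval_mul]
    refine ncard_rankChains_rees_cons hpr hrk_bot hrk_top fix (q := []) hs hsn
      (fun c hc => ?_) (by simp; omega)
      (fun c hc => ncard_rankChains_rees hpr hrk_bot hrk_top fix L s hsorted
        (fun u hu => (hmem u (by simp [hu])).2) c hc)
    have hlen := ((hpr _).1 c.2).2.2
    simp only [augLe, true_iff]
    exact ⟨bot_le, List.nil_prefix, by simp; omega⟩

end rees

section mobius

theorem sum_powerset_alternating_inversion (f : Finset ℕ → ℤ) (T : Finset ℕ) :
    ∑ S ∈ T.powerset, ∑ U ∈ S.powerset, (-1 : ℤ) ^ (S \ U).card * f U = f T := by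
  rw [Finset.sum_comm' (t' := T.powerset) (s' := fun U => Finset.Icc U T)]
  · rw [Finset.sum_eq_single_of_mem T (Finset.mem_powerset_self T)]
    · simp
    · intro U hU hne
      have hU := Finset.mem_powerset.1 hU
      rw [← Finset.sum_mul, Finset.Icc_eq_image_powerset hU, Finset.sum_image]
      · rw [Finset.sum_congr rfl (g := fun V => (-1 : ℤ) ^ V.card),
          Finset.sum_powerset_neg_one_pow_card_of_nonempty, zero_mul]
        · rw [Finset.sdiff_nonempty]
          exact fun h => hne (hU.antisymm h)
        · intro V hV
          have hdisj : Disjoint V U :=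
            Finset.disjoint_of_subset_left (Finset.mem_powerset.1 hV) Finset.sdiff_disjoint
          rw [Finset.union_sdiff_cancel_left hdisj.symm]
      · intro V hV W hW hVW
        have hdV : Disjoint V U :=
          Finset.disjoint_of_subset_left (Finset.mem_powerset.1 hV) Finset.sdiff_disjoint
        have hdW : Disjoint W U :=
          Finset.disjoint_of_subset_left (Finset.mem_powerset.1 hW) Finset.sdiff_disjoint
        rw [← Finset.union_sdiff_cancel_left hdV.symm, ← Finset.union_sdiff_cancel_left hdW.symm]
        exact congrArg (· \ U) hVW
  · intro S U
    simp only [Finset.mem_powerset, Finset.mem_Icc]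
    exact ⟨fun h => ⟨⟨h.2, h.1⟩, h.2.trans h.1⟩, fun h => ⟨h.1.2, h.1.1⟩⟩

theorem sum_powerset_eq_double_sum {n : ℕ} {a b w : Finset ℕ → ℤ}
    (hb : ∀ T ⊆ Finset.Icc 1 n, b T = a T * w T) :
    ∑ T ∈ (Finset.Icc 1 n).powerset, (-1 : ℤ) ^ (Finset.Icc 1 n \ T).card * b T =
      ∑ S ∈ (Finset.Icc 1 n).powerset, (∑ U ∈ S.powerset, (-1 : ℤ) ^ (S \ U).card * a U) *
        ∑ T ∈ (Finset.Icc 1 n).powerset.filter (fun T => S ⊆ T),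
          (-1 : ℤ) ^ (n - T.card) * w T := by
  simp_rw [Finset.mul_sum (s := Finset.filter _ _)]
  rw [Finset.sum_comm' (t' := (Finset.Icc 1 n).powerset) (s' := fun T => T.powerset)]
  · refine Finset.sum_congr rfl fun T hT => ?_
    have hT := Finset.mem_powerset.1 hT
    rw [← Finset.sum_mul, sum_powerset_alternating_inversion, hb T hT,
      Finset.card_sdiff_of_subset hT, Nat.card_Icc, Nat.add_sub_cancel]
    ring
  · intro S T
    simp only [Finset.mem_powerset, Finset.mem_filter]
    exact ⟨fun h => ⟨h.2.2, h.2.1⟩, fun h => ⟨h.1.trans h.2, h.2, h.1⟩⟩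

end mobius

theorem betaQ_betaR_eq_double_sum (n t : ℕ) (hn : 1 ≤ n) (ht : 1 ≤ t)
    (P : Type) [Fintype P] [PartialOrder P] [BoundedOrder P] (rk : P → ℕ)
    (hrk_bot : rk ⊥ = 0) (hrk_top : rk ⊤ = n + 1)
    (hgraded : ∀ x y : P, x ⋖ y → rk y = rk x + 1)
    (G : Type) [Group G] [Fintype G] [MulAction G P]
    (hact : ∀ (g : G) (x y : P), x ≤ y → g • x ≤ g • y) (g : G) :
    betaQ P G rk t n (Finset.Icc 1 n) g =
      (∑ S ∈ (Finset.Icc 1 n).powerset, betaP P G rk S g *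
        ∑ T ∈ (Finset.Icc 1 n).powerset.filter (fun T => S ⊆ T),
          (-1 : ℤ) ^ (n - T.card) * (phi T).eval (t : ℤ)) ∧
    betaR P G rk t n (Finset.Icc 1 n) g =
      (∑ S ∈ (Finset.Icc 1 n).powerset, betaP P G rk S g *
        ∑ T ∈ (Finset.Icc 1 n).powerset.filter (fun T => S ⊆ T),
          (-1 : ℤ) ^ (n - T.card) * (psi T).eval (t : ℤ)) := by
  have hmono := strictMono_of_graded hgraded
  have hfb : g • (⊥ : P) = ⊥ := le_bot_iff.1 <| by
    simpa using hact g ⊥ (g⁻¹ • ⊥) bot_le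
  have hft : g • (⊤ : P) = ⊤ := top_le_iff.1 <| by
    simpa using hact g (g⁻¹ • ⊤) ⊤ le_top
  constructor
  · refine sum_powerset_eq_double_sum fun T hT => ?_
    have hLe : QLe P rk t n = augLe fun c c' => reesLe P rk c.val c'.val := by
      funext x y
      rcases x with _ | _ | c <;> rcases y with _ | _ | c' <;> rfl
    have hRank : QRank P rk t n = augRank n fun c => rk c.val.1 := by
      funext x
      rcases x with _ | _ | c <;> rfl
    have hFix : QFix P G rk t n g = augFix fun c => g • c.val.1 = c.val.1 := by
      funext x
      rcases x with _ | _ | c <;> rfl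
    have hphi : phi T = reesWeight 0 (T.sort (· ≤ ·)) := by
      unfold phi
      cases T.sort (· ≤ ·) <;> rfl
    rw [alphaQ, alphaP, hLe, hRank, hFix, hphi]
    refine nFixedMaxChains_rees (fix := fun p => g • p = p) hrk_bot hrk_top hgraded zero_le_one
      (fun pq => ?_) hfb hft hT
    constructor
    · rintro ⟨h1, h2, h3, h4⟩
      refine ⟨h1, fun h => h4 ⟨h, ?_⟩, h3⟩
      rw [h, hrk_bot] at h3
      exact List.length_eq_zero_iff.1 (by omega)
    · rintro ⟨h1, h2, h3⟩
      have := hmono (lt_top_iff_ne_top.2 h1)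
      exact ⟨h1, by omega, h3, fun h => h2 h.1⟩
  · refine sum_powerset_eq_double_sum fun T hT => ?_
    have hLe : RLe P rk t n = augLe fun c c' => reesLe P rk c.val c'.val := by
      funext x y
      rcases x with _ | _ | c <;> rcases y with _ | _ | c' <;> rfl
    have hRank : RRank P rk t n = augRank n fun c => rk c.val.1 := by
      funext x
      rcases x with _ | _ | c <;> rfl
    have hFix : RFix P G rk t n g = augFix fun c => g • c.val.1 = c.val.1 := by
      funext x
      rcases x with _ | _ | c <;> rfl
    have hpsi : psi T = reesWeight 1 (T.sort (· ≤ ·)) := by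
      unfold psi
      cases T.sort (· ≤ ·) <;> rfl
    rw [alphaR, alphaP, hLe, hRank, hFix, hpsi]
    refine nFixedMaxChains_rees (fix := fun p => g • p = p) hrk_bot hrk_top hgraded le_rfl
      (fun pq => ?_) hfb hft hT
    constructor
    · rintro ⟨h1, h2, h3, h4⟩
      exact ⟨h1, h2, h4⟩
    · rintro ⟨h1, h2, h3⟩
      have := hmono (lt_top_iff_ne_top.2 h1)
      exact ⟨h1, h2, by omega, h3⟩

end
end
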